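/- Let D ∈ ℝ^{n×n} be an invertible diagonal matrix, F_i, F_j ∈ ℝ^{m×n}, G_i, G_j ∈ ℝ^m, h ∈ ℝⁿ nonzero, k ∈ ℝ, and ε, ε₁ ≥ 0. Consider the rescaled control laws u_i(x) = F_i D⁻¹ x + G_i and u_j(x) = F_j D⁻¹ x + G_j, and assume F_i D⁻¹ z + G_i = F_j D⁻¹ z + G_j for every z ∈ ℝⁿ with h·z = k. Let x, Δx ∈ ℝⁿ with ‖Δx‖_∞ ≤ ε, let ΔF ∈ ℝ^{m×n} have every entry of absolute value at most ε₁, and let ΔG ∈ ℝ^m with ‖ΔG‖_∞ ≤ ε₁; set x̂ = x + Δx and δ = ε(‖h‖₁ + ‖x‖₁ + nε + 1). If |h·x − k| ≤ δ, then ‖(F_i D⁻¹ + ΔF) x̂ + (G_i + ΔG) − (F_j D⁻¹ x + G_j)‖_∞ ≤ (δ/‖h‖₂²)·‖(F_i − F_j) D⁻¹ hᵀ‖_∞ + ε‖F_i D⁻¹‖_∞ + nε₁‖x‖_∞ + nεε₁ + ε₁, where for a matrix A, ‖A‖_∞ is the maximum absolute row sum. -/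

import Mathlib

open Matrix BigOperators

/-- The operator norm induced by the vector `∞`-norm: the maximum absolute row sum. -/
noncomputable def matNormInf {m n : ℕ} (A : Matrix (Fin m) (Fin n) ℝ) : ℝ :=
  ‖(fun i : Fin m => ∑ j, |A i j|)‖

theorem norm_mulVec_le_matNormInf_mul {m n : ℕ} (A : Matrix (Fin m) (Fin n) ℝ) (v : Fin n → ℝ) :
    ‖A *ᵥ v‖ ≤ matNormInf A * ‖v‖ := by
  refine (pi_norm_le_iff_of_nonneg (mul_nonneg (norm_nonneg _) (norm_nonneg _))).2 fun i => ?_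
  have hrow : ∑ j, |A i j| ≤ matNormInf A :=
    (le_abs_self _).trans (norm_le_pi_norm (fun i : Fin m => ∑ j, |A i j|) i)
  calc ‖(A *ᵥ v) i‖ ≤ ∑ j, ‖A i j * v j‖ := norm_sum_le Finset.univ fun j => A i j * v j
    _ ≤ ∑ j, |A i j| * ‖v‖ := by
        refine Finset.sum_le_sum fun j _ => ?_
        rw [norm_mul, Real.norm_eq_abs (A i j)]
        exact mul_le_mul_of_nonneg_left (norm_le_pi_norm v j) (abs_nonneg _)
    _ = (∑ j, |A i j|) * ‖v‖ := (Finset.sum_mul _ _ _).symm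
    _ ≤ matNormInf A * ‖v‖ := mul_le_mul_of_nonneg_right hrow (norm_nonneg _)

theorem matNormInf_le_of_abs_le {m n : ℕ} {A : Matrix (Fin m) (Fin n) ℝ} {c : ℝ} (hc : 0 ≤ c)
    (hA : ∀ i j, |A i j| ≤ c) : matNormInf A ≤ n * c := by
  refine (pi_norm_le_iff_of_nonneg (by positivity)).2 fun i => ?_
  rw [Real.norm_of_nonneg (Finset.sum_nonneg fun j _ => abs_nonneg _)]
  calc ∑ j, |A i j| ≤ ∑ _j : Fin n, c := Finset.sum_le_sum fun j _ => hA i j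
    _ = n * c := by simp

/-- If two affine maps agree on the hyperplane `h ⬝ᵥ z = k`, their difference at `x` is determined
by the signed distance from `x` to the hyperplane. -/
theorem affine_sub_eq_smul_of_agree_on_hyperplane {m n : ℕ} {A B : Matrix (Fin m) (Fin n) ℝ}
    {a b : Fin m → ℝ} {h : Fin n → ℝ} (hne : h ≠ 0) {k : ℝ}
    (hagree : ∀ z : Fin n → ℝ, h ⬝ᵥ z = k → A *ᵥ z + a = B *ᵥ z + b) (x : Fin n → ℝ) :
    A *ᵥ x + a - (B *ᵥ x + b) = ((h ⬝ᵥ x - k) / (h ⬝ᵥ h)) • ((A - B) *ᵥ h) := by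
  have hh : h ⬝ᵥ h ≠ 0 := fun H => hne (dotProduct_self_eq_zero.1 H)
  have hz := hagree (x - ((h ⬝ᵥ x - k) / (h ⬝ᵥ h)) • h) (by
    rw [dotProduct_sub, dotProduct_smul, smul_eq_mul, div_mul_cancel₀ _ hh, sub_sub_cancel])
  simp only [mulVec_sub, mulVec_smul] at hz
  rw [sub_mulVec, smul_sub]
  rw [← sub_eq_zero] at hz ⊢
  rw [← hz]
  abel

/-- The rescaled control-error bound of Section III-A: the state is rescaled by an invertible
diagonal matrix `D`, the region data are quantized with precision `ε`, and the gains and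
offsets are quantized with a (possibly different) precision `ε₁`. -/
theorem rescaled_control_error_bound {m n : ℕ}
    (D : Matrix (Fin n) (Fin n) ℝ) (hDdiag : D.IsDiag) (hDinv : IsUnit D.det)
    (Fi Fj : Matrix (Fin m) (Fin n) ℝ) (Gi Gj : Fin m → ℝ)
    (h : Fin n → ℝ) (hne : h ≠ 0) (k ε ε₁ : ℝ) (hε : 0 ≤ ε) (hε₁ : 0 ≤ ε₁)
    (hagree : ∀ z : Fin n → ℝ, h ⬝ᵥ z = k →
      (Fi * D⁻¹) *ᵥ z + Gi = (Fj * D⁻¹) *ᵥ z + Gj)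
    (x Δx : Fin n → ℝ) (hΔx : ‖Δx‖ ≤ ε)
    (ΔF : Matrix (Fin m) (Fin n) ℝ) (hΔF : ∀ i j, |ΔF i j| ≤ ε₁)
    (ΔG : Fin m → ℝ) (hΔG : ‖ΔG‖ ≤ ε₁)
    (hjump : |h ⬝ᵥ x - k| ≤ ε * ((∑ i, |h i|) + (∑ i, |x i|) + (n : ℝ) * ε + 1)) :
    ‖(Fi * D⁻¹ + ΔF) *ᵥ (x + Δx) + (Gi + ΔG) - ((Fj * D⁻¹) *ᵥ x + Gj)‖ ≤
      (ε * ((∑ i, |h i|) + (∑ i, |x i|) + (n : ℝ) * ε + 1) / (∑ i, (h i) ^ 2)) *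
          ‖((Fi - Fj) * D⁻¹) *ᵥ h‖ +
        ε * matNormInf (Fi * D⁻¹) + (n : ℝ) * ε₁ * ‖x‖ + (n : ℝ) * ε * ε₁ + ε₁ := by
  set δ := ε * ((∑ i, |h i|) + (∑ i, |x i|) + (n : ℝ) * ε + 1)
  have hs : h ⬝ᵥ h = ∑ i, (h i) ^ 2 := by simp [dotProduct, sq]
  have hjumpEq := affine_sub_eq_smul_of_agree_on_hyperplane hne hagree x
  rw [← Matrix.sub_mul, hs] at hjumpEq
  have hsplit : (Fi * D⁻¹ + ΔF) *ᵥ (x + Δx) + (Gi + ΔG) - ((Fj * D⁻¹) *ᵥ x + Gj) =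
      ((h ⬝ᵥ x - k) / ∑ i, (h i) ^ 2) • (((Fi - Fj) * D⁻¹) *ᵥ h) +
        (Fi * D⁻¹) *ᵥ Δx + ΔF *ᵥ x + ΔF *ᵥ Δx + ΔG := by
    rw [← hjumpEq, add_mulVec, mulVec_add, mulVec_add]
    abel
  have hs0 : 0 ≤ ∑ i, (h i) ^ 2 := Finset.sum_nonneg fun i _ => sq_nonneg _
  have hgap : ‖((h ⬝ᵥ x - k) / ∑ i, (h i) ^ 2) • (((Fi - Fj) * D⁻¹) *ᵥ h)‖ ≤
      δ / (∑ i, (h i) ^ 2) * ‖((Fi - Fj) * D⁻¹) *ᵥ h‖ := by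
    rw [norm_smul, Real.norm_eq_abs, abs_div, abs_of_nonneg hs0]
    gcongr
  have hstate : ‖(Fi * D⁻¹) *ᵥ Δx‖ ≤ ε * matNormInf (Fi * D⁻¹) := by
    rw [mul_comm ε]
    exact (norm_mulVec_le_matNormInf_mul _ _).trans
      (mul_le_mul_of_nonneg_left hΔx (norm_nonneg _))
  have hgain (v : Fin n → ℝ) : ‖ΔF *ᵥ v‖ ≤ n * ε₁ * ‖v‖ :=
    (norm_mulVec_le_matNormInf_mul _ _).trans
      (mul_le_mul_of_nonneg_right (matNormInf_le_of_abs_le hε₁ hΔF) (norm_nonneg _))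
  have hcross : ‖ΔF *ᵥ Δx‖ ≤ n * ε * ε₁ := by
    rw [mul_right_comm]
    exact (hgain Δx).trans (mul_le_mul_of_nonneg_left hΔx (by positivity))
  rw [hsplit]
  exact norm_add_le_of_le (norm_add_le_of_le (norm_add_le_of_le (norm_add_le_of_le hgap hstate)
    (hgain x)) hcross) hΔG
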